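/- Let L > 0 and let u : ℝ × ℝ → ℝ be smooth, m := u − u_{xx}, with m(x,t) + 1 > 0 for all (x,t), u(x + L, t) = u(x, t) for all (x,t), and (√(m+1))_t = −( u √(m+1) )_x on ℝ × ℝ. Define y(x,t) := ∫₀ˣ √(m(ξ,t)+1) dξ − ∫₀ᵗ u(0,ζ) √(m(0,ζ)+1) dζ, and let x̃ : ℝ × ℝ → ℝ be smooth with x̃( y(x,t), t ) = x and y( x̃(η,t), t ) = η for all x, η, t. Set θ := ∫₀ᴸ √(m(ξ,0)+1) dξ, and define m̂(η,t) := m( x̃(η,t), t ), û(η,t) := u( x̃(η,t), t ), v̂(η,t) := u_x( x̃(η,t), t ). Then for all (η,t): x̃(η + θ, t) − x̃(η, t) = L, m̂(η + θ, t) = m̂(η, t), û(η + θ, t) = û(η, t), and v̂(η + θ, t) = v̂(η, t). -/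

import Mathlib

/-- Partial derivative with respect to the first variable. -/
noncomputable def pd1 (f : ℝ → ℝ → ℝ) (x t : ℝ) : ℝ := deriv (fun x' => f x' t) x

/-- Partial derivative with respect to the second (time) variable. -/
noncomputable def pd2 (f : ℝ → ℝ → ℝ) (x t : ℝ) : ℝ := deriv (fun t' => f x t') t

theorem hasDerivAt_pd1 {f : ℝ → ℝ → ℝ} (hf : ContDiff ℝ (⊤ : ℕ∞) (Function.uncurry f)) (x t : ℝ) :
    HasDerivAt (fun x' => f x' t) (pd1 f x t) x := by
  have h : ContDiff ℝ (⊤ : ℕ∞) (fun x' : ℝ => Function.uncurry f (x', t)) := by fun_prop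
  exact (h.differentiable (by simp) x).hasDerivAt

theorem hasDerivAt_pd2 {f : ℝ → ℝ → ℝ} (hf : ContDiff ℝ (⊤ : ℕ∞) (Function.uncurry f)) (x t : ℝ) :
    HasDerivAt (fun t' => f x t') (pd2 f x t) t := by
  have h : ContDiff ℝ (⊤ : ℕ∞) (fun t' : ℝ => Function.uncurry f (x, t')) := by fun_prop
  exact (h.differentiable (by simp) t).hasDerivAt

theorem contDiff_uncurry_pd1 {f : ℝ → ℝ → ℝ} (hf : ContDiff ℝ (⊤ : ℕ∞) (Function.uncurry f)) :
    ContDiff ℝ (⊤ : ℕ∞) (Function.uncurry (pd1 f)) := by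
  have h : Function.uncurry (pd1 f)
      = fun p => fderiv ℝ (Function.uncurry f) p ((1 : ℝ), (0 : ℝ)) := by
    funext ⟨x, t⟩
    have h1 := (hf.differentiable (by simp) (x, t)).hasFDerivAt
    have h2 : HasDerivAt (fun x' : ℝ => (x', t)) ((1 : ℝ), (0 : ℝ)) x :=
      (hasDerivAt_id x).prodMk (hasDerivAt_const x t)
    exact (h1.comp_hasDerivAt x h2).deriv
  rw [h]
  exact (hf.fderiv_right (m := (⊤ : ℕ∞)) (by simp)).clm_apply contDiff_const

theorem contDiff_uncurry_pd2 {f : ℝ → ℝ → ℝ} (hf : ContDiff ℝ (⊤ : ℕ∞) (Function.uncurry f)) :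
    ContDiff ℝ (⊤ : ℕ∞) (Function.uncurry (pd2 f)) := by
  have h : Function.uncurry (pd2 f)
      = fun p => fderiv ℝ (Function.uncurry f) p ((0 : ℝ), (1 : ℝ)) := by
    funext ⟨x, t⟩
    have h1 := (hf.differentiable (by simp) (x, t)).hasFDerivAt
    have h2 : HasDerivAt (fun t' : ℝ => (x, t')) ((0 : ℝ), (1 : ℝ)) t :=
      (hasDerivAt_const t x).prodMk (hasDerivAt_id t)
    exact (h1.comp_hasDerivAt t h2).deriv
  rw [h]
  exact (hf.fderiv_right (m := (⊤ : ℕ∞)) (by simp)).clm_apply contDiff_const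

theorem pd1_periodic {f : ℝ → ℝ → ℝ} {L : ℝ} (hper : ∀ x t, f (x + L) t = f x t) (x t : ℝ) :
    pd1 f (x + L) t = pd1 f x t := by
  have h := deriv_comp_add_const (fun x' => f x' t) L x
  simp only [hper] at h
  exact h.symm

/-- Differentiation under the integral sign for a smooth integrand over a compact interval. -/
theorem hasDerivAt_intervalIntegral_pd2 {f : ℝ → ℝ → ℝ}
    (hf : ContDiff ℝ (⊤ : ℕ∞) (Function.uncurry f)) (a b t : ℝ) :
    HasDerivAt (fun t' => ∫ x in a..b, f x t') (∫ x in a..b, pd2 f x t) t := by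
  have hf2 := (contDiff_uncurry_pd2 hf).continuous
  have hc : ∀ s, Continuous fun x => f x s := fun s =>
    hf.continuous.comp (Continuous.prodMk_left s)
  have hc2 : ∀ s, Continuous fun x => pd2 f x s := fun s =>
    hf2.comp (Continuous.prodMk_left s)
  obtain ⟨C, hC⟩ := ((isCompact_uIcc (a := a) (b := b)).prod
    (isCompact_closedBall t 1)).exists_bound_of_continuousOn hf2.continuousOn
  refine (intervalIntegral.hasDerivAt_integral_of_dominated_loc_of_deriv_le
    (F := fun s x => f x s) (F' := fun s x => pd2 f x s) (bound := fun _ => C)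
    (Metric.closedBall_mem_nhds t one_pos) ?_ ?_ ?_ ?_ ?_ ?_).2
  · exact Filter.Eventually.of_forall fun s => (hc s).aestronglyMeasurable
  · exact (hc t).intervalIntegrable a b
  · exact (hc2 t).aestronglyMeasurable
  · exact Filter.Eventually.of_forall fun x hx s hs =>
      hC (x, s) ⟨Set.uIoc_subset_uIcc hx, hs⟩
  · exact intervalIntegrable_const
  · exact Filter.Eventually.of_forall fun x _ s _ => hasDerivAt_pd2 hf x s

/-- The integral over a period of a smooth periodic density `w` satisfying a conservation law
`w_t = -q_x` with smooth periodic flux does not depend on time. -/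
theorem integral_period_eq_of_conservation {w q : ℝ → ℝ → ℝ} {L : ℝ}
    (hw : ContDiff ℝ (⊤ : ℕ∞) (Function.uncurry w))
    (hq : ContDiff ℝ (⊤ : ℕ∞) (Function.uncurry q))
    (hqper : ∀ x t, q (x + L) t = q x t)
    (h : ∀ x t, pd2 w x t = -pd1 q x t) (s t : ℝ) :
    ∫ x in (0 : ℝ)..L, w x s = ∫ x in (0 : ℝ)..L, w x t := by
  have hzero : ∀ r, ∫ x in (0 : ℝ)..L, pd2 w x r = 0 := fun r => by
    have hc : Continuous fun x => pd1 q x r :=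
      (contDiff_uncurry_pd1 hq).continuous.comp (Continuous.prodMk_left r)
    have hL := hqper 0 r
    rw [zero_add] at hL
    simp only [h, intervalIntegral.integral_neg]
    rw [intervalIntegral.integral_eq_sub_of_hasDerivAt (fun x _ => hasDerivAt_pd1 hq x r)
      (hc.intervalIntegrable 0 L), hL, sub_self, neg_zero]
  have hd := hasDerivAt_intervalIntegral_pd2 hw 0 L
  exact is_const_of_deriv_eq_zero (fun r => (hd r).differentiableAt)
    (fun r => (hd r).deriv.trans (hzero r)) s t

/-- an `L`-periodic solution of the Camassa–Holm equation in the `(x,t)`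
variables gives, via the change of variable `y`, a `θ`-periodic solution in the `(y,t)`
variables, with `θ = ∫₀ᴸ √(m(ξ,0)+1) dξ`. -/
theorem statement3
    (L : ℝ) (hL : 0 < L)
    (u : ℝ → ℝ → ℝ) (hu : ContDiff ℝ (⊤ : ℕ∞) (Function.uncurry u))
    (m : ℝ → ℝ → ℝ) (hm : ∀ x t, m x t = u x t - pd1 (pd1 u) x t)
    (hpos : ∀ x t, m x t + 1 > 0)
    (hper : ∀ x t, u (x + L) t = u x t)
    (hCH : ∀ x t, pd2 (fun x' t' => Real.sqrt (m x' t' + 1)) x t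
        = - pd1 (fun x' t' => u x' t' * Real.sqrt (m x' t' + 1)) x t)
    (y : ℝ → ℝ → ℝ)
    (hy : ∀ x t, y x t = (∫ ξ in (0:ℝ)..x, Real.sqrt (m ξ t + 1))
        - ∫ ζ in (0:ℝ)..t, u 0 ζ * Real.sqrt (m 0 ζ + 1))
    (xt : ℝ → ℝ → ℝ) (hxtS : ContDiff ℝ (⊤ : ℕ∞) (Function.uncurry xt))
    (hinv1 : ∀ x t, xt (y x t) t = x)
    (hinv2 : ∀ η t, y (xt η t) t = η)
    (θ : ℝ) (hθ : θ = ∫ ξ in (0:ℝ)..L, Real.sqrt (m ξ 0 + 1))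
    (mh uh vh : ℝ → ℝ → ℝ)
    (hmh : ∀ η t, mh η t = m (xt η t) t)
    (huh : ∀ η t, uh η t = u (xt η t) t)
    (hvh : ∀ η t, vh η t = pd1 u (xt η t) t) :
    ∀ η t, (xt (η + θ) t - xt η t = L)
      ∧ (mh (η + θ) t = mh η t)
      ∧ (uh (η + θ) t = uh η t)
      ∧ (vh (η + θ) t = vh η t) := by
  have hmper : ∀ x t, m (x + L) t = m x t := fun x t => by
    rw [hm, hm, hper, pd1_periodic (pd1_periodic hper)]
  have hmS : ContDiff ℝ (⊤ : ℕ∞) (Function.uncurry m) := by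
    have h : Function.uncurry m
        = fun p => Function.uncurry u p - Function.uncurry (pd1 (pd1 u)) p := by
      funext ⟨x, t⟩
      exact hm x t
    rw [h]
    exact hu.sub (contDiff_uncurry_pd1 (contDiff_uncurry_pd1 hu))
  have hw : ContDiff ℝ (⊤ : ℕ∞) (Function.uncurry fun x t => Real.sqrt (m x t + 1)) :=
    (hmS.add contDiff_const).sqrt fun p => (hpos p.1 p.2).ne'
  have hq : ContDiff ℝ (⊤ : ℕ∞) (Function.uncurry fun x t => u x t * Real.sqrt (m x t + 1)) :=
    hu.mul hw
  have hθt : ∀ t, ∫ ξ in (0 : ℝ)..L, Real.sqrt (m ξ t + 1) = θ := fun t => by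
    rw [hθ]
    exact integral_period_eq_of_conservation hw hq (fun x t => by simp only [hper, hmper]) hCH t 0
  have hyper : ∀ x t, y (x + L) t = y x t + θ := fun x t => by
    have hc : Continuous fun ξ => Real.sqrt (m ξ t + 1) :=
      hw.continuous.comp (Continuous.prodMk_left t)
    have hp : Function.Periodic (fun ξ => Real.sqrt (m ξ t + 1)) L := fun ξ => by
      simp only [hmper]
    have h := hp.intervalIntegral_add_eq x 0
    rw [zero_add, hθt] at h
    rw [hy, hy, ← intervalIntegral.integral_add_adjacent_intervals
      (hc.intervalIntegrable 0 x) (hc.intervalIntegrable x (x + L)), h]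
    ring
  intro η t
  have hx : xt (η + θ) t = xt η t + L := by
    rw [← hinv1 (xt η t + L) t, hyper, hinv2]
  refine ⟨by rw [hx]; ring, ?_, ?_, ?_⟩
  · rw [hmh, hmh, hx, hmper]
  · rw [huh, huh, hx, hper]
  · rw [hvh, hvh, hx, pd1_periodic hper]
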